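/- arXiv:math/0512180 — 6 statements merged into one kernel-verified Lean document; each statement's English description precedes it below -/
import Mathlib

section
/- Suppose G is a finitely presented group and N is a normal subgroup of G such that both N and the quotient group G/N have Property (FA). Then G has Property (FA). -/
/-- A group `G` has Property (FA) if every action of `G` without inversions on a tree
(a connected acyclic simple graph), by graph automorphisms, has a fixed vertex. -/
def HasPropertyFA (G : Type*) [Group G] : Prop :=
  ∀ (V : Type) (T : SimpleGraph V) (φ : G →* Equiv.Perm V),
    T.Connected → T.IsAcyclic →
    (∀ (g : G) (u v : V), T.Adj u v → T.Adj (φ g u) (φ g v)) →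
    (∀ (g : G) (u v : V), T.Adj u v → ¬(φ g u = v ∧ φ g v = u)) →
    ∃ x : V, ∀ g : G, φ g x = x

/-- A group is finitely presented if it is the quotient of a finitely generated free group
by the normal closure of finitely many relators. -/
def Group.FinitelyPresented (G : Type*) [Group G] : Prop :=
  ∃ (n : ℕ) (rels : Set (FreeGroup (Fin n))),
    rels.Finite ∧ Nonempty (PresentedGroup rels ≃* G)

/-- A graph automorphism of an acyclic graph fixing both endpoints of a path fixes every vertex
of the path. -/
theorem SimpleGraph.IsAcyclic.map_eq_self_of_mem_support {V : Type*} {T : SimpleGraph V}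
    (hT : T.IsAcyclic) (f : T →g T) (hf : Function.Injective f) {x y : V} (hx : f x = x)
    (hy : f y = y) {p : T.Walk x y} (hp : p.IsPath) {v : V} (hv : v ∈ p.support) : f v = v := by
  have hq : ((p.map f).copy hx hy).IsPath := by
    simpa using hp.map hf
  have h : (p.map f).copy hx hy = p :=
    congrArg Subtype.val ((hT.subsingleton_path x y).elim ⟨_, hq⟩ ⟨p, hp⟩)
  have hs : p.support.map f = p.support.map id := by
    simpa using congrArg SimpleGraph.Walk.support h
  exact List.map_inj_left.mp hs v hv

/-- If `G` is finitely presented, `N ⊴ G`, and both `N` and `G/N` have Property (FA),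
then so does `G`. -/
theorem propertyFA_of_normal_of_quotient (G : Type) [Group G]
    (hfp : Group.FinitelyPresented G) (N : Subgroup G) [N.Normal]
    (hN : HasPropertyFA N) (hQ : HasPropertyFA (G ⧸ N)) :
    HasPropertyFA G := by
  intro V T φ hconn hacyc hadj hinv
  let S : Set V := {x | ∀ n ∈ N, φ n x = x}
  obtain ⟨x₀, hx₀⟩ := hN V T (φ.comp N.subtype) hconn hacyc (fun g => hadj g) (fun g => hinv g)
  have hS : ∀ g x, x ∈ S → φ g x ∈ S := by
    intro g x hx n hn
    have h := hx (g⁻¹ * n * g) (by simpa using ‹N.Normal›.conj_mem n hn g⁻¹)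
    simpa [Equiv.symm_apply_eq] using h
  have hS_iff : ∀ g x, φ g x ∈ S ↔ x ∈ S := fun g x =>
    ⟨fun h => by simpa using hS g⁻¹ _ h, hS g x⟩
  let ψ : G →* Equiv.Perm S :=
    MonoidHom.mk' (fun g => (φ g).subtypePerm (hS_iff g)) fun g h => by
      ext x
      exact congrArg (· x.1) (map_mul φ g h)
  have hψ : ∀ n ∈ N, ψ n = 1 := by
    intro n hn
    ext x
    exact x.2 n hn
  have hSconn : (T.induce S).Connected := by
    have : Nonempty S := ⟨⟨x₀, fun n hn => hx₀ ⟨n, hn⟩⟩⟩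
    refine ⟨fun x y => ?_⟩
    obtain ⟨p, hp⟩ := hconn.exists_isPath x.1 y.1
    exact ⟨p.induce S fun v hv n hn =>
      hacyc.map_eq_self_of_mem_support ⟨φ n, hadj n _ _⟩ (φ n).injective
        (x.2 n hn) (y.2 n hn) hp hv⟩
  obtain ⟨x, hx⟩ := hQ S (T.induce S) (QuotientGroup.lift N ψ hψ) hSconn (hacyc.induce S)
    (fun q => QuotientGroup.induction_on q fun g u v h => hadj g u v h)
    (fun q => QuotientGroup.induction_on q fun g u v h h' =>
      hinv g u v h ⟨congrArg Subtype.val h'.1, congrArg Subtype.val h'.2⟩)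
  exact ⟨x, fun g => congrArg Subtype.val (hx g)⟩
end

section
/- Suppose a group G is generated by two subgroups A and B, where A is generated by a family of elements (a_i) and B is generated by a family of elements (b_j). Suppose G acts without inversions on a tree T such that the set of vertices fixed by all of A is nonempty, the set of vertices fixed by all of B is nonempty, and for every i and j the element a_i·b_j fixes some vertex of T. Then there is a vertex of T fixed by every element of G. -/
namespace SimpleGraph

variable {V : Type*} {T : SimpleGraph V}

/-- In a tree, a vertex lying between `x` and `y` is determined by its distance to `x`. -/
theorem IsAcyclic.eq_of_dist_add_dist_eq (hT : T.IsAcyclic) (hc : T.Connected) {x y p q : V}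
    (hp : T.dist x p + T.dist p y = T.dist x y) (hq : T.dist x q + T.dist q y = T.dist x y)
    (hpq : T.dist x p = T.dist x q) : p = q := by
  have key : ∀ r : V, T.dist x r + T.dist r y = T.dist x y →
      ∃ w : T.Walk x y, w.IsPath ∧ w.getVert (T.dist x r) = r := by
    intro r hr
    obtain ⟨w₁, h₁⟩ := hc.exists_walk_length_eq_dist x r
    obtain ⟨w₂, h₂⟩ := hc.exists_walk_length_eq_dist r y
    refine ⟨w₁.append w₂, Walk.isPath_of_length_eq_dist _ ?_, ?_⟩
    · rw [Walk.length_append, h₁, h₂, hr]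
    · simp [← h₁, Walk.getVert_append]
  obtain ⟨w, hw, hwp⟩ := key p hp
  obtain ⟨w', hw', hwq⟩ := key q hq
  have := congrArg Subtype.val ((hT.subsingleton_path x y).elim ⟨w, hw⟩ ⟨w', hw'⟩)
  simp only at this
  rw [← hwp, ← hwq, this, hpq]

/-- Automorphisms of a connected graph preserve distances. -/
theorem Connected.dist_apply_iso (hc : T.Connected) (f : T ≃g T) (x y : V) :
    T.dist (f x) (f y) = T.dist x y := by
  have key : ∀ (g : T ≃g T) (x y : V), T.dist (g x) (g y) ≤ T.dist x y := by
    intro g x y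
    obtain ⟨w, hw⟩ := hc.exists_walk_length_eq_dist x y
    rw [← hw, ← Walk.length_map g.toHom w]
    exact dist_le _
  refine (key f x y).antisymm ?_
  simpa using key f.symm (f x) (f y)

/-- Distinct vertices `x`, `y` of a connected graph: `x` has a neighbour closer to `y`. -/
theorem Connected.exists_adj_dist_add_one_eq (hc : T.Connected) {x y : V} (h : x ≠ y) :
    ∃ u, T.Adj x u ∧ T.dist u y + 1 = T.dist x y := by
  obtain ⟨w, hw⟩ := hc.exists_walk_length_eq_dist x y
  cases w with
  | nil => exact absurd rfl h
  | @cons _ u _ hadj p =>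
    refine ⟨u, hadj, ?_⟩
    have h₁ := dist_le p
    have h₂ := hc.dist_triangle (u := x) (v := u) (w := y)
    rw [dist_eq_one_iff_adj.2 hadj] at h₂
    rw [Walk.length_cons] at hw
    omega

/-- A geodesic in a tree whose first step leads away from `z` keeps leading away from `z`. -/
theorem IsTree.dist_add_dist_eq_of_adj (hT : T.IsTree) {x x' y z : V} (hadj : T.Adj x x')
    (hy : T.dist x' y + 1 = T.dist x y) (hz : T.dist x' z = T.dist x z + 1) :
    T.dist x y + T.dist x z = T.dist y z := by
  induction hn : T.dist x' y generalizing x x' with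
  | zero =>
    obtain rfl := hT.connected.dist_eq_zero_iff.1 hn
    omega
  | succ n ih =>
    have hne : x' ≠ y := by rintro rfl; simp at hn
    obtain ⟨u, hu, huy⟩ := hT.connected.exists_adj_dist_add_one_eq hne
    have hxu : u ≠ x := by rintro rfl; omega
    have huz : T.dist u z = T.dist x' z + 1 := by
      have h₁ := hT.dist_eq_dist_add_one_of_adj z hu
      rw [dist_comm (u := z), dist_comm (u := z)] at h₁
      refine h₁.resolve_left fun h₂ => hxu ?_
      have du := dist_eq_one_iff_adj.2 hu
      have dx := dist_eq_one_iff_adj.2 hadj.symm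
      exact hT.isAcyclic.eq_of_dist_add_dist_eq hT.connected (x := x') (y := z)
        (by omega) (by omega) (by omega)
    have := ih hu huy huz (by omega)
    omega

/-- Any three vertices of a tree have a median. -/
theorem IsTree.exists_median (hT : T.IsTree) (x y z : V) :
    ∃ c, T.dist x c + T.dist c y = T.dist x y ∧ T.dist x c + T.dist c z = T.dist x z ∧
      T.dist y c + T.dist c z = T.dist y z := by
  induction hn : T.dist x y generalizing x with
  | zero =>
    obtain rfl := hT.connected.dist_eq_zero_iff.1 hn
    exact ⟨x, by simp⟩
  | succ n ih =>
    have hne : x ≠ y := by rintro rfl; simp at hn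
    obtain ⟨u, hu, huy⟩ := hT.connected.exists_adj_dist_add_one_eq hne
    have h₁ := hT.dist_eq_dist_add_one_of_adj z hu
    rw [dist_comm (u := z), dist_comm (u := z)] at h₁
    rcases h₁ with h₁ | h₁
    · obtain ⟨c, hcy, hcz, hyz⟩ := ih u (by omega)
      have t₁ := hT.connected.dist_triangle (u := x) (v := u) (w := c)
      have t₂ := hT.connected.dist_triangle (u := x) (v := c) (w := y)
      rw [dist_eq_one_iff_adj.2 hu] at t₁
      exact ⟨c, by omega, by omega, hyz⟩
    · have h₂ := hT.dist_add_dist_eq_of_adj hu huy h₁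
      refine ⟨x, by simpa using hn, by simp, ?_⟩
      rw [dist_comm, h₂]

/-- An automorphism of a tree fixing `x` and `y` fixes every vertex between them. -/
theorem IsTree.apply_eq_of_dist_add_dist_eq (hT : T.IsTree) (f : T ≃g T) {x y p : V}
    (hx : f x = x) (hy : f y = y) (hp : T.dist x p + T.dist p y = T.dist x y) : f p = p := by
  have h₁ : T.dist x (f p) = T.dist x p := by
    conv_lhs => rw [← hx]
    exact hT.connected.dist_apply_iso f _ _
  have h₂ : T.dist (f p) y = T.dist p y := by
    conv_lhs => rw [← hy]
    exact hT.connected.dist_apply_iso f _ _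
  exact hT.isAcyclic.eq_of_dist_add_dist_eq hT.connected (by rw [h₁, h₂, hp]) hp h₁

/-- The midpoint of `z` and `f z` is fixed by `f` as soon as `f` has a fixed vertex. -/
theorem IsTree.exists_midpoint_apply_eq (hT : T.IsTree) (f : T ≃g T) {y z : V} (hy : f y = y) :
    ∃ c, f c = c ∧ T.dist z c = T.dist c (f z) ∧ T.dist z c + T.dist c (f z) = T.dist z (f z) := by
  obtain ⟨c, h₁, h₂, h₃⟩ := hT.exists_median y z (f z)
  have hyz : T.dist y (f z) = T.dist y z := by
    conv_lhs => rw [← hy]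
    exact hT.connected.dist_apply_iso f _ _
  have hyc : T.dist y (f c) = T.dist y c := by
    conv_lhs => rw [← hy]
    exact hT.connected.dist_apply_iso f _ _
  have hcz : T.dist (f c) (f z) = T.dist c z := hT.connected.dist_apply_iso f _ _
  have hzc := T.dist_comm (u := z) (v := c)
  exact ⟨c, hT.isAcyclic.eq_of_dist_add_dist_eq hT.connected (by omega) h₂ hyc, by omega, h₃⟩

/-- If `f`, `g` and `f ∘ g` all have fixed vertices in a tree, then `f` and `g` have a common
fixed vertex. -/
theorem IsTree.exists_common_fixed (hT : T.IsTree) (f g : T ≃g T) {x y z : V} (hx : f x = x)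
    (hy : g y = y) (hz : f (g z) = z) : ∃ c, f c = c ∧ g c = c := by
  obtain ⟨c, hc, h₁, h₂⟩ := hT.exists_midpoint_apply_eq g (z := z) hy
  obtain ⟨d, hd, h₃, h₄⟩ := hT.exists_midpoint_apply_eq f (z := g z) hx
  rw [hz] at h₃ h₄
  have e₁ := T.dist_comm (u := g z) (v := d)
  have e₂ := T.dist_comm (u := d) (v := z)
  have e₃ := T.dist_comm (u := g z) (v := z)
  obtain rfl : c = d :=
    hT.isAcyclic.eq_of_dist_add_dist_eq hT.connected h₂ (by omega) (by omega)
  exact ⟨c, hd, hc⟩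

/-- Let `f` fix `x`, let `g` fix `y`, and let `f` and `g` have a common fixed vertex. Then `f`
fixes the neighbour of `x` towards `y`, or `g` fixes `x`. -/
theorem IsTree.apply_adj_eq_or_apply_eq (hT : T.IsTree) (f g : T ≃g T) {x u y m : V}
    (hx : f x = x) (hy : g y = y) (hfm : f m = m) (hgm : g m = m) (hu : T.Adj x u)
    (huy : T.dist u y + 1 = T.dist x y) : f u = u ∨ g x = x := by
  obtain ⟨c, hxy, hxm, hym⟩ := hT.exists_median x y m
  have hfc := hT.apply_eq_of_dist_add_dist_eq f hx hfm hxm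
  have hgc := hT.apply_eq_of_dist_add_dist_eq g hy hgm hym
  rcases eq_or_ne x c with rfl | hne
  · exact .inr hgc
  · obtain ⟨v, hv, hvc⟩ := hT.connected.exists_adj_dist_add_one_eq hne
    have dv := dist_eq_one_iff_adj.2 hv
    have du := dist_eq_one_iff_adj.2 hu
    have t₁ := hT.connected.dist_triangle (u := v) (v := c) (w := y)
    have t₂ := hT.connected.dist_triangle (u := x) (v := v) (w := y)
    obtain rfl : u = v :=
      hT.isAcyclic.eq_of_dist_add_dist_eq hT.connected (x := x) (y := y)
        (by omega) (by omega) (by omega)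
    exact .inl (hT.apply_eq_of_dist_add_dist_eq f hx hfc (by omega))

end SimpleGraph

/-- A vertex fixed by a set of group elements is fixed by the subgroup they generate. -/
theorem MonoidHom.apply_eq_of_mem_closure {G V : Type*} [Group G] (φ : G →* Equiv.Perm V)
    {s : Set G} {x : V} (hs : ∀ g ∈ s, φ g x = x) {g : G} (hg : g ∈ Subgroup.closure s) :
    φ g x = x := by
  have : Subgroup.closure s ≤ (MulAction.stabilizer (Equiv.Perm V) x).comap φ :=
    (Subgroup.closure_le _).2 hs
  exact this hg

/-- **Serre.** Let `G` be generated by subgroups `A = ⟨a_i⟩` and `B = ⟨b_j⟩`, acting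
without inversions on a tree `T`. If the fixed sets of `A` and of `B` are nonempty and
every product `a_i * b_j` fixes a vertex, then `G` fixes a vertex. -/
theorem fixed_point_of_generating_subgroups
    (G : Type) [Group G] (V : Type) (T : SimpleGraph V) (φ : G →* Equiv.Perm V)
    (hconn : T.Connected) (hacyc : T.IsAcyclic)
    (hauto : ∀ (g : G) (u v : V), T.Adj u v → T.Adj (φ g u) (φ g v))
    (hnoinv : ∀ (g : G) (u v : V), T.Adj u v → ¬(φ g u = v ∧ φ g v = u))
    {ι κ : Type} (a : ι → G) (b : κ → G) (A B : Subgroup G)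
    (hA : A = Subgroup.closure (Set.range a))
    (hB : B = Subgroup.closure (Set.range b))
    (hgen : A ⊔ B = ⊤)
    (hAfix : ∃ x : V, ∀ g ∈ A, φ g x = x)
    (hBfix : ∃ x : V, ∀ g ∈ B, φ g x = x)
    (hab : ∀ (i : ι) (j : κ), ∃ x : V, φ (a i * b j) x = x) :
    ∃ x : V, ∀ g : G, φ g x = x := by
  have hT : T.IsTree := ⟨hconn, hacyc⟩
  let F : G → (T ≃g T) := fun g =>
    { toEquiv := φ g
      map_rel_iff' := fun {u v} =>
        ⟨fun h => by simpa using hauto g⁻¹ _ _ h, hauto g u v⟩ }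
  obtain ⟨x, hx⟩ := hAfix
  obtain ⟨y, hy⟩ := hBfix
  have haA : ∀ i, a i ∈ A := fun i => hA ▸ Subgroup.subset_closure ⟨i, rfl⟩
  have hbB : ∀ j, b j ∈ B := fun j => hB ▸ Subgroup.subset_closure ⟨j, rfl⟩
  have hfinish : ∀ v, (∀ g ∈ A, φ g v = v) → (∀ g ∈ B, φ g v = v) →
      ∃ v, ∀ g : G, φ g v = v := by
    intro v hvA hvB
    refine ⟨v, fun g => φ.apply_eq_of_mem_closure (s := (A : Set G) ∪ B) ?_ ?_⟩
    · rintro h (hh | hh)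
      exacts [hvA h hh, hvB h hh]
    · rw [← Subgroup.sup_eq_closure, hgen]
      trivial
  induction hn : T.dist x y generalizing x with
  | zero =>
    obtain rfl := hconn.dist_eq_zero_iff.1 hn
    exact hfinish x hx hy
  | succ n ih =>
    have hne : x ≠ y := by rintro rfl; simp at hn
    obtain ⟨u, hu, huy⟩ := hconn.exists_adj_dist_add_one_eq hne
    have key : ∀ i j, φ (a i) u = u ∨ φ (b j) x = x := by
      intro i j
      obtain ⟨z, hz⟩ := hab i j
      rw [map_mul] at hz
      obtain ⟨m, hm₁, hm₂⟩ := hT.exists_common_fixed (F (a i)) (F (b j))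
        (hx _ (haA i)) (hy _ (hbB j)) hz
      exact hT.apply_adj_eq_or_apply_eq (F (a i)) (F (b j))
        (hx _ (haA i)) (hy _ (hbB j)) hm₁ hm₂ hu huy
    by_cases hfix : ∀ i, φ (a i) u = u
    · refine ih u (fun g hg => ?_) (by omega)
      rw [hA] at hg
      exact φ.apply_eq_of_mem_closure (by rintro _ ⟨i, rfl⟩; exact hfix i) hg
    · obtain ⟨i, hi⟩ := not_forall.1 hfix
      refine hfinish x hx fun g hg => ?_
      rw [hB] at hg
      exact φ.apply_eq_of_mem_closure
        (by rintro _ ⟨j, rfl⟩; exact (key i j).resolve_left hi) hg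
end

section
/- Let G be a group and Δ a normal subgroup of G such that G/Δ is isomorphic to the infinite dihedral group D∞. Let (N_i)_{i ∈ ι} be a family of finite-index normal subgroups of G such that no N_i admits a surjective homomorphism onto ℤ. Then the intersection over all i of the subgroups N_i·Δ (the subgroup of G generated by N_i and Δ) is not equal to Δ. -/
/-- A group with a nontrivial homomorphism to `ℤ` surjects onto `ℤ`. -/
theorem exists_surjective_int_of_ne_one {H : Type*} [Group H] (f : H →* Multiplicative ℤ)
    {h : H} (hh : f h ≠ 1) : ∃ g : H →* Multiplicative ℤ, Function.Surjective g := by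
  have : Infinite f.range := by
    refine Infinite.of_injective (fun n : ℤ => (⟨f h ^ n, h ^ n, map_zpow f h n⟩ : f.range)) ?_
    intro m n hmn
    have h1 : m * (f h).toAdd = n * (f h).toAdd := by
      simpa using congrArg Multiplicative.toAdd (Subtype.ext_iff.mp hmn)
    exact mul_right_cancel₀ (fun h0 => hh (Multiplicative.toAdd.injective h0)) h1
  let e : f.range ≃* Multiplicative ℤ := mulEquivOfCyclicCardEq <| by
    rw [Nat.card_eq_zero_of_infinite, Nat.card_eq_zero_of_infinite]
  exact ⟨e.toMonoidHom.comp f.rangeRestrict,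
    e.surjective.comp f.rangeRestrict_surjective⟩

/-- A finite-index subgroup which does not surject onto `ℤ` maps some element to a reflection
under any surjection onto the infinite dihedral group. -/
theorem exists_map_eq_sr_of_no_surjective_int {G : Type*} [Group G]
    (φ : G →* DihedralGroup 0) (hφ : Function.Surjective φ)
    (N : Subgroup G) [N.FiniteIndex]
    (hN : ¬ ∃ f : N →* Multiplicative ℤ, Function.Surjective f) :
    ∃ n ∈ N, ∃ k, φ n = DihedralGroup.sr k := by
  by_contra! hsr
  have hr : ∀ n : N, ∃ k : ZMod 0, φ n = DihedralGroup.r k := by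
    intro n
    cases h : φ n with
    | r k => exact ⟨k, rfl⟩
    | sr k => exact absurd h (hsr n n.2 k)
  choose a ha using hr
  let f : N →* Multiplicative ℤ := MonoidHom.mk' (fun n => Multiplicative.ofAdd (α := ℤ) (a n)) <| by
    intro m n
    have h := ha (m * n)
    rw [Subgroup.coe_mul, map_mul, ha, ha, DihedralGroup.r_mul_r] at h
    exact congrArg (Multiplicative.ofAdd (α := ℤ)) (DihedralGroup.r.inj h).symm
  obtain ⟨t, ht⟩ := hφ (DihedralGroup.r 1)
  obtain ⟨k, hk, -, hmem⟩ := N.exists_pow_mem_of_index_ne_zero Subgroup.FiniteIndex.index_ne_zero t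
  refine hN (exists_surjective_int_of_ne_one f (h := ⟨t ^ k, hmem⟩) fun h1 => ?_)
  have h2 : a ⟨t ^ k, hmem⟩ = 0 := h1
  have h3 := ha ⟨t ^ k, hmem⟩
  rw [h2] at h3
  simp only [map_pow, ht, DihedralGroup.r_one_pow] at h3
  have h4 : 0 ∣ k := (ZMod.natCast_eq_zero_iff k 0).mp (DihedralGroup.r.inj h3)
  exact hk.ne' (zero_dvd_iff.mp h4)

/-- A normal subgroup whose image in the infinite dihedral group contains a reflection has
image containing the square of the generating rotation. -/
theorem exists_map_eq_r_two_of_map_eq_sr {G : Type*} [Group G]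
    (φ : G →* DihedralGroup 0) (hφ : Function.Surjective φ)
    (N : Subgroup G) [N.Normal] {n : G} (hn : n ∈ N) {k : ZMod 0}
    (hk : φ n = DihedralGroup.sr k) : ∃ m ∈ N, φ m = DihedralGroup.r 2 := by
  obtain ⟨t, ht⟩ := hφ (DihedralGroup.r 1)
  refine ⟨t * n * t⁻¹ * n, N.mul_mem (Subgroup.Normal.conj_mem ‹_› n hn t) hn, ?_⟩
  simp only [map_mul, map_inv, hk, ht, DihedralGroup.inv_r, DihedralGroup.r_mul_sr,
    DihedralGroup.sr_mul_r, DihedralGroup.sr_mul_sr]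
  congr 1
  ring


/-- Let `Δ ⊴ G` with `G/Δ ≅ D∞`, and let `(N i)` be a family of finite-index normal
subgroups of `G` none of which surjects onto `ℤ`. Then `⨅ i, N i ⊔ Δ ≠ Δ`. -/
theorem iInf_join_ne_of_dihedral_quotient
    (G : Type) [Group G] (Δ : Subgroup G) [Δ.Normal]
    (hquot : Nonempty ((G ⧸ Δ) ≃* DihedralGroup 0))
    {ι : Type} (N : ι → Subgroup G)
    (hnormal : ∀ i, (N i).Normal)
    (hfin : ∀ i, (N i).FiniteIndex)
    (hnoZ : ∀ i, ¬ ∃ f : (N i) →* Multiplicative ℤ, Function.Surjective f) :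
    (⨅ i, (N i) ⊔ Δ) ≠ Δ := by

  obtain ⟨e⟩ := hquot
  let φ : G →* DihedralGroup 0 := e.toMonoidHom.comp (QuotientGroup.mk' Δ)
  have hφ : Function.Surjective φ := e.surjective.comp (QuotientGroup.mk'_surjective Δ)
  have hker : ∀ g, φ g = 1 ↔ g ∈ Δ := fun g => by simp [φ]
  obtain ⟨g, hg⟩ := hφ (DihedralGroup.r 2)
  have hmem : g ∈ ⨅ i, N i ⊔ Δ := by
    refine Subgroup.mem_iInf.mpr fun i => ?_
    have := hnormal i
    have := hfin i
    obtain ⟨n, hn, k, hk⟩ := exists_map_eq_sr_of_no_surjective_int φ hφ (N i) (hnoZ i)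
    obtain ⟨m, hm, hm2⟩ := exists_map_eq_r_two_of_map_eq_sr φ hφ (N i) hn hk
    have hd : m⁻¹ * g ∈ Δ := (hker _).mp (by rw [map_mul, map_inv, hm2, hg, inv_mul_cancel])
    simpa using Subgroup.mul_mem_sup hm hd
  intro heq
  rw [heq, ← hker, hg, DihedralGroup.one_def] at hmem
  exact absurd (DihedralGroup.r.inj hmem) (by decide)
end

section
/- Let G be a group that splits as a nontrivial free product with amalgamation A *_C B, i.e., G is the pushout of injective homomorphisms C → A and C → B, neither of which is surjective. Then every element of the center of G lies in the image of C in G. -/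
/-- A witness that `G` is a nontrivial free product with amalgamation `A *_C B`:
injective, non-surjective maps `C → A`, `C → B`, and maps `A → G`, `B → G`
exhibiting `G` as the pushout (via the universal property). -/
structure AmalgamSplitting (G : Type) [Group G] where
  A : Type
  B : Type
  C : Type
  [groupA : Group A]
  [groupB : Group B]
  [groupC : Group C]
  f : C →* A
  g : C →* B
  ia : A →* G
  ib : B →* G
  f_inj : Function.Injective f
  g_inj : Function.Injective g
  f_not_surj : ¬ Function.Surjective f
  g_not_surj : ¬ Function.Surjective g
  comm : ia.comp f = ib.comp g
  isPushout : ∀ (H : Type) [Group H] (ja : A →* H) (jb : B →* H),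
    ja.comp f = jb.comp g → ∃! h : G →* H, h.comp ia = ja ∧ h.comp ib = jb

/-- `G` splits as a nontrivial free product with amalgamation. -/
def SplitsAsNontrivialAmalgam (G : Type) [Group G] : Prop :=
  Nonempty (AmalgamSplitting G)


namespace Monoid.PushoutI

open NormalWord

section NormalForm

variable {ι : Type*} {G : ι → Type*} {H : Type*} [∀ i, Group (G i)] [Group H]
  {φ : ∀ i, H →* G i} {d : Transversal φ}

theorem NormalWord.fstIdx_cons {i : ι} (g : G i) (w : NormalWord d) (hmw : w.fstIdx ≠ some i)
    (hgr : g ∉ (φ i).range) : (cons g w hmw hgr).fstIdx = some i := rfl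

variable [DecidableEq ι] [∀ i, DecidableEq (G i)]

theorem NormalWord.fstIdx_base_smul (h : H) (w : NormalWord d) :
    (base φ h • w).fstIdx = w.fstIdx := rfl

theorem NormalWord.fstIdx_of_smul {i : ι} {g : G i} {w : NormalWord d}
    (hmw : w.fstIdx ≠ some i) (hgr : g ∉ (φ i).range) :
    (of (φ := φ) i g • w).fstIdx = some i := by
  rw [← cons_eq_smul g w hmw hgr, fstIdx_cons]

theorem NormalWord.fstIdx_of_smul_empty {j : ι} (b : G j) :
    (of (φ := φ) j b • (empty : NormalWord d)).fstIdx = none ∨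
      (of (φ := φ) j b • (empty : NormalWord d)).fstIdx = some j := by
  by_cases hb : b ∈ (φ j).range
  · obtain ⟨c, rfl⟩ := hb
    left
    rw [of_apply_eq_base, fstIdx_base_smul]
    rfl
  · exact .inr (fstIdx_of_smul (by simp [CoprodI.Word.fstIdx, empty, CoprodI.Word.empty]) hb)

theorem NormalWord.eq_base_smul_empty_of_fstIdx_eq_none {w : NormalWord d}
    (hw : w.fstIdx = none) : w = base φ w.head • empty := by
  refine NormalWord.ext (by simp [base_smul_def]) ?_
  have : w.toList = [] := by simpa [CoprodI.Word.fstIdx] using hw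
  rw [this]
  rfl

/-- Multiplying a normal word on the right by an element of the `j`-th group does not change the
index of its first letter, except possibly when both words are empty or start in the `j`-th
group. -/
theorem NormalWord.fstIdx_prod_smul_of {j : ι} (b : G j) (w : NormalWord d) :
    (w.prod • of (φ := φ) j b • (empty : NormalWord d)).fstIdx = w.fstIdx ∨
      (w.fstIdx = none ∨ w.fstIdx = some j) ∧
      ((w.prod • of (φ := φ) j b • (empty : NormalWord d)).fstIdx = none ∨
        (w.prod • of (φ := φ) j b • (empty : NormalWord d)).fstIdx = some j) := by
  induction w using consRecOn with
  | empty =>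
    rw [prod_empty, one_smul]
    exact .inr ⟨.inl rfl, fstIdx_of_smul_empty b⟩
  | cons i g w hmw _ hgr hw1 ih =>
    rw [prod_cons, mul_smul, fstIdx_cons]
    by_cases hij : i = j
    · subst hij
      rcases hw : w.fstIdx with _ | k
      · have hwe := eq_base_smul_empty_of_fstIdx_eq_none hw
        rw [hw1, map_one, one_smul] at hwe
        rw [hwe, prod_empty, one_smul, ← mul_smul, ← map_mul]
        exact .inr ⟨.inr rfl, fstIdx_of_smul_empty _⟩
      · left
        refine fstIdx_of_smul ?_ hgr
        rcases ih with ih | ⟨ih | ih, -⟩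
        · rwa [ih]
        · simp [hw] at ih
        · exact absurd ih hmw
    · left
      refine fstIdx_of_smul ?_ hgr
      rcases ih with ih | ⟨-, ih | ih⟩
      · rwa [ih]
      · simp [ih]
      · simpa [ih] using Ne.symm hij
  | base h w _ ih => rwa [prod_smul, mul_smul, fstIdx_base_smul, fstIdx_base_smul]

end NormalForm

/-- If at least two of the maps in the diagram are not surjective, then the center of the
amalgamated product is contained in the base group. -/
theorem center_le_range_base {ι : Type*} {G : ι → Type*} {H : Type*} [∀ i, Group (G i)] [Group H]
    {φ : ∀ i, H →* G i} (hφ : ∀ i, Function.Injective (φ i))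
    (hns : ∀ i, ∃ j, j ≠ i ∧ ¬ Function.Surjective (φ j)) :
    Subgroup.center (PushoutI φ) ≤ (base φ).range := by
  classical
  obtain ⟨d⟩ := transversal_nonempty φ hφ
  intro z hz
  have hprod : (z • (empty : NormalWord d)).prod = z := by simp
  rcases hw : (z • (empty : NormalWord d)).fstIdx with _ | i
  · have h := congrArg NormalWord.prod (eq_base_smul_empty_of_fstIdx_eq_none hw)
    rw [hprod, prod_smul, prod_empty, mul_one] at h
    exact ⟨_, h.symm⟩
  · obtain ⟨j, hji, hj⟩ := hns i
    obtain ⟨b, hb⟩ : ∃ b, b ∉ (φ j).range := by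
      simpa [Function.Surjective] using hj
    have hij : some i ≠ some j := by simpa using hji.symm
    have h₁ := fstIdx_of_smul (by rwa [hw]) hb
    rw [← mul_smul, Subgroup.mem_center_iff.mp hz, mul_smul] at h₁
    have h₂ := fstIdx_prod_smul_of b (z • (empty : NormalWord d))
    rw [hprod, h₁, hw] at h₂
    simp [hij, hij.symm] at h₂

end Monoid.PushoutI

/-- The pair of groups `A`, `B` as a family indexed by `Bool`. -/
abbrev boolFamily (A B : Type) (b : Bool) : Type := Bool.rec B A b

instance boolFamilyGroup (A B : Type) [Group A] [Group B] : ∀ b, Group (boolFamily A B b)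
  | true => ‹Group A›
  | false => ‹Group B›

/-- A pair of homomorphisms out of `C` as a family indexed by `Bool`. -/
def boolFamilyFrom {A B C : Type} [Group A] [Group B] [Group C] (f : C →* A) (g : C →* B) :
    ∀ b, C →* boolFamily A B b
  | true => f
  | false => g

/-- A pair of homomorphisms into `G` as a family indexed by `Bool`. -/
def boolFamilyTo {A B G : Type} [Group A] [Group B] [Group G] (f : A →* G) (g : B →* G) :
    ∀ b, boolFamily A B b →* G
  | true => f
  | false => g

open Monoid in
theorem center_le_range_of_isPushout {G A B C : Type} [Group G] [Group A] [Group B] [Group C]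
    {f : C →* A} {g : C →* B} {ia : A →* G} {ib : B →* G}
    (hf : Function.Injective f) (hg : Function.Injective g)
    (hf' : ¬ Function.Surjective f) (hg' : ¬ Function.Surjective g)
    (comm : ia.comp f = ib.comp g)
    (isPushout : ∀ (H : Type) [Group H] (ja : A →* H) (jb : B →* H),
      ja.comp f = jb.comp g → ∃! h : G →* H, h.comp ia = ja ∧ h.comp ib = jb) :
    Subgroup.center G ≤ (ia.comp f).range := by
  let φ := boolFamilyFrom f g
  let k : PushoutI φ →* G := PushoutI.lift (boolFamilyTo ia ib) (ia.comp f)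
    (by rintro (_ | _); exacts [comm.symm, rfl])
  obtain ⟨h, ⟨hA, hB⟩, -⟩ := isPushout (PushoutI φ) (PushoutI.of (φ := φ) true)
    (PushoutI.of (φ := φ) false)
    ((PushoutI.of_comp_eq_base (φ := φ) true).trans (PushoutI.of_comp_eq_base (φ := φ) false).symm)
  have kA (a : A) : k (PushoutI.of (φ := φ) true a) = ia a := PushoutI.lift_of ..
  have kB (b : B) : k (PushoutI.of (φ := φ) false b) = ib b := PushoutI.lift_of ..
  have hA' (a : A) : h (ia a) = PushoutI.of (φ := φ) true a := DFunLike.congr_fun hA a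
  have hB' (b : B) : h (ib b) = PushoutI.of (φ := φ) false b := DFunLike.congr_fun hB b
  have hkh : k.comp h = .id G := (isPushout G ia ib comm).unique
    ⟨by ext a; simp [hA', kA], by ext b; simp [hB', kB]⟩ ⟨rfl, rfl⟩
  have hhk : h.comp k = .id (PushoutI φ) := by
    refine PushoutI.hom_ext_nonempty ?_
    rintro (_ | _)
    · ext b; exact (congrArg h (kB b)).trans (hB' b)
    · ext a; exact (congrArg h (kA a)).trans (hA' a)
  intro z hz
  have hcenter : h z ∈ Subgroup.center (PushoutI φ) := by
    refine Subgroup.mem_center_iff.mpr fun x => ?_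
    have hx : h (k x) = x := DFunLike.congr_fun hhk x
    rw [← hx, ← map_mul, ← map_mul, Subgroup.mem_center_iff.mp hz]
  obtain ⟨c, hc⟩ := PushoutI.center_le_range_base
    (by rintro (_ | _); exacts [hg, hf])
    (by rintro (_ | _); exacts [⟨true, by simp, hf'⟩, ⟨false, by simp, hg'⟩]) hcenter
  refine ⟨c, ?_⟩
  have hz' : k (h z) = z := DFunLike.congr_fun hkh z
  rw [← hz', ← hc]
  exact (PushoutI.lift_base ..).symm

/-- In any nontrivial free product with amalgamation `G = A *_C B`, the center of `G`
lies in the image of the amalgamating subgroup `C`. -/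
theorem center_le_amalgamating_subgroup (G : Type) [Group G] (s : AmalgamSplitting G) :
    letI := s.groupA; letI := s.groupB; letI := s.groupC;
    Subgroup.center G ≤ (s.ia.comp s.f).range := by
  let := s.groupA
  let := s.groupB
  let := s.groupC
  exact center_le_range_of_isPushout s.f_inj s.g_inj s.f_not_surj s.g_not_surj s.comm s.isPushout
end

section
/- The (2,3,6) triangle group Δ(2,3,6), presented as ⟨a, b : a² = 1, b³ = 1, (ab)⁶ = 1⟩, has Property (FA). -/
/-- The relators `a²`, `b³`, `(ab)⁶` of the (2,3,6) triangle group, where `a` and `b` are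
the two generators of the free group on two letters. -/
def triangleRels236 : Set (FreeGroup (Fin 2)) :=
  {(FreeGroup.of 0) ^ 2, (FreeGroup.of 1) ^ 3, (FreeGroup.of 0 * FreeGroup.of 1) ^ 6}

namespace SimpleGraph

variable {V : Type*} {T : SimpleGraph V}

theorem IsTree.eq_of_adj_of_dist_add_one (hT : T.IsTree) {r x u w : V}
    (hu : T.Adj u x) (hw : T.Adj w x) (hru : T.dist r x = T.dist r u + 1)
    (hrw : T.dist r x = T.dist r w + 1) : u = w := by
  obtain ⟨p, hp⟩ := hT.connected.exists_walk_length_eq_dist r u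
  obtain ⟨q, hq⟩ := hT.connected.exists_walk_length_eq_dist r w
  have hp' : (p.concat hu).IsPath := Walk.isPath_of_length_eq_dist _ (by simp [hp, hru])
  have hq' : (q.concat hw).IsPath := Walk.isPath_of_length_eq_dist _ (by simp [hq, hrw])
  have h : p.concat hu = q.concat hw := (hT.existsUnique_path r x).unique hp' hq'
  simpa using congrArg Walk.penultimate h

/-- In a tree, a sequence of consecutively adjacent vertices without backtracking is geodesic. -/
theorem IsTree.dist_eq_of_forall_ne (hT : T.IsTree) {f : ℕ → V}
    (hadj : ∀ i, T.Adj (f i) (f (i + 1))) (hne : ∀ i, f (i + 2) ≠ f i) (n : ℕ) :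
    T.dist (f 0) (f n) = n := by
  suffices h : T.dist (f 0) (f n) = n ∧ T.dist (f 0) (f (n + 1)) = n + 1 from h.1
  induction n with
  | zero => exact ⟨dist_self, by simpa using hadj 0⟩
  | succ n ih =>
    refine ⟨ih.2, ?_⟩
    rcases hT.dist_eq_dist_add_one_of_adj (f 0) (hadj (n + 1)) with h | h
    · refine absurd (hT.eq_of_adj_of_dist_add_one (hadj (n + 1)).symm (hadj n) h ?_) (hne n)
      rw [ih.1, ih.2]
    · rw [h, ih.2]

/-- A nonbacktracking path from `p 0` to `g (p 0)` whose concatenation with its translate by `g`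
does not backtrack lies on an axis of `g`, so no positive power of `g` fixes `p 0`. -/
theorem IsTree.pow_apply_ne_of_axis (hT : T.IsTree) {g : Equiv.Perm V}
    (hg : ∀ u v, T.Adj u v → T.Adj (g u) (g v)) {p : ℕ → V} {m : ℕ} (hm : 0 < m)
    (hend : p m = g (p 0)) (hadj : ∀ i < m, T.Adj (p i) (p (i + 1)))
    (hne : ∀ i, i + 2 ≤ m → p (i + 2) ≠ p i) (hjoin : g (p 1) ≠ p (m - 1))
    {k : ℕ} (hk : 0 < k) : (g ^ k) (p 0) ≠ p 0 := by
  let f : ℕ → V := fun n ↦ (g ^ (n / m)) (p (n % m))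
  have hf_add (n : ℕ) : f (n + m) = g (f n) := by
    simp only [f, Nat.add_div_right n hm, Nat.add_mod_right, pow_succ', Equiv.Perm.mul_apply]
  have hf_lt {n : ℕ} (hn : n < m) : f n = p n := by
    simp [f, Nat.div_eq_of_lt hn, Nat.mod_eq_of_lt hn]
  have hf_le {n : ℕ} (hn : n ≤ m) : f n = p n := by
    rcases hn.lt_or_eq with hn | rfl
    · exact hf_lt hn
    · rw [hend, ← hf_lt hm, ← hf_add, zero_add]
  have hf_adj (n : ℕ) : T.Adj (f n) (f (n + 1)) := by
    induction n using Nat.strong_induction_on with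
    | _ n ih =>
      by_cases hn : n < m
      · rw [hf_le hn.le, hf_le hn]
        exact hadj n hn
      · obtain ⟨j, rfl⟩ := Nat.exists_eq_add_of_le' (not_lt.mp hn)
        rw [add_right_comm, hf_add, hf_add]
        exact hg _ _ (ih j (by omega))
  have hf_ne (n : ℕ) : f (n + 2) ≠ f n := by
    induction n using Nat.strong_induction_on with
    | _ n ih =>
      by_cases hn : n < m
      · by_cases hn2 : n + 2 ≤ m
        · rw [hf_le hn.le, hf_le hn2]
          exact hne n hn2
        · obtain rfl : m = n + 1 := by omega
          rw [show n + 2 = 1 + (n + 1) by omega, hf_add, hf_le hm, hf_le n.le_succ]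
          exact hjoin
      · obtain ⟨j, rfl⟩ := Nat.exists_eq_add_of_le' (not_lt.mp hn)
        rw [add_right_comm, hf_add, hf_add]
        exact g.injective.ne (ih j (by omega))
  have hdist := hT.dist_eq_of_forall_ne hf_adj hf_ne (k * m)
  intro h
  have hfk : f (k * m) = p 0 := by simpa [f, hm] using h
  rw [hfk, hf_lt hm, dist_self] at hdist
  exact (Nat.mul_pos hk hm).ne hdist

theorem Connected.dist_le_of_adj (hT : T.Connected) {p : ℕ → V} {m : ℕ}
    (hadj : ∀ i < m, T.Adj (p i) (p (i + 1))) {i j : ℕ} (hij : i ≤ j) (hj : j ≤ m) :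
    T.dist (p i) (p j) ≤ j - i := by
  induction j, hij using Nat.le_induction with
  | base => simp
  | succ j hij ih =>
    have h1 := hT.dist_triangle (u := p i) (v := p j) (w := p (j + 1))
    have h2 := dist_eq_one_iff_adj.mpr (hadj j hj)
    have h3 := ih (by omega)
    omega

theorem Connected.exists_geodesic (hT : T.Connected) (u v : V) :
    ∃ p : ℕ → V, p 0 = u ∧ p (T.dist u v) = v ∧
      (∀ i < T.dist u v, T.Adj (p i) (p (i + 1))) ∧
      ∀ i, i + 2 ≤ T.dist u v → p (i + 2) ≠ p i := by
  obtain ⟨w, hw⟩ := hT.exists_walk_length_eq_dist u v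
  have hadj : ∀ i < T.dist u v, T.Adj (w.getVert i) (w.getVert (i + 1)) :=
    fun i hi ↦ w.adj_getVert_succ (hw ▸ hi)
  have hend : w.getVert (T.dist u v) = v := by rw [← hw, w.getVert_length]
  refine ⟨w.getVert, w.getVert_zero, hend, hadj, fun i hi h ↦ ?_⟩
  have h1 := hT.dist_le_of_adj hadj (Nat.zero_le i) (by omega)
  have h2 := hT.dist_le_of_adj hadj hi le_rfl
  have h3 := hT.dist_triangle (u := u) (v := w.getVert i) (w := v)
  rw [w.getVert_zero] at h1
  rw [h, hend] at h2
  omega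

/-- A tree automorphism of finite order that does not invert an edge fixes a vertex. -/
theorem IsTree.exists_apply_eq_of_pow_eq_one (hT : T.IsTree) {g : Equiv.Perm V}
    (hg : ∀ u v, T.Adj u v → T.Adj (g u) (g v))
    (hinv : ∀ u v, T.Adj u v → ¬(g u = v ∧ g v = u)) {k : ℕ} (hk : 0 < k) (hgk : g ^ k = 1) :
    ∃ v, g v = v := by
  have := hT.connected.nonempty
  let v := Function.argmin (fun v ↦ T.dist v (g v))
  have hmin (u : V) : T.dist v (g v) ≤ T.dist u (g u) :=
    Function.argmin_le (fun v ↦ T.dist v (g v)) u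
  by_contra! hfix
  have hm : 0 < T.dist v (g v) := hT.connected.pos_dist_of_ne (hfix v).symm
  obtain ⟨p, hp0, hpm, hadj, hne⟩ := hT.connected.exists_geodesic v (g v)
  generalize T.dist v (g v) = m at *
  refine hT.pow_apply_ne_of_axis hg hm (hpm.trans (hp0 ▸ rfl)) hadj hne (fun hjoin ↦ ?_) hk
    (by rw [hgk, Equiv.Perm.one_apply])
  rcases (Nat.succ_le_of_lt hm).eq_or_lt with rfl | hm2
  · exact hinv _ _ (hadj 0 one_pos) ⟨by simp_all, hjoin⟩
  · have h1 := hT.connected.dist_le_of_adj hadj (i := 1) (j := m - 1) (by omega) (by omega)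
    have h2 := hmin (p 1)
    rw [hjoin] at h2
    omega

/-- If two automorphisms of a tree each fix a vertex and their product has finite order, then they
have a common fixed vertex. -/
theorem IsTree.exists_common_fixed_of_mul_pow_eq_one (hT : T.IsTree) {a b : Equiv.Perm V}
    (ha : ∀ u v, T.Adj u v → T.Adj (a u) (a v)) (hb : ∀ u v, T.Adj u v → T.Adj (b u) (b v))
    (hafix : ∃ v, a v = v) (hbfix : ∃ v, b v = v) {k : ℕ} (hk : 0 < k) (hab : (a * b) ^ k = 1) :
    ∃ v, a v = v ∧ b v = v := by
  obtain ⟨x₀, hx₀⟩ := hafix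
  obtain ⟨y₀, hy₀⟩ := hbfix
  have : Nonempty {q : V × V // b q.1 = q.1 ∧ a q.2 = q.2} := ⟨⟨(y₀, x₀), hy₀, hx₀⟩⟩
  let d : {q : V × V // b q.1 = q.1 ∧ a q.2 = q.2} → ℕ := fun q ↦ T.dist q.1.1 q.1.2
  obtain ⟨⟨⟨y, x⟩, hy, hx⟩, hq⟩ : ∃ q, ∀ q', d q ≤ d q' :=
    ⟨Function.argmin d, fun q ↦ Function.argmin_le d q⟩
  have hmin (y' x' : V) (hy' : b y' = y') (hx' : a x' = x') : T.dist y x ≤ T.dist y' x' :=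
    hq ⟨(y', x'), hy', hx'⟩
  dsimp only at hx hy
  by_contra! hfix
  have hn : 0 < T.dist y x := by
    refine hT.connected.pos_dist_of_ne ?_
    rintro rfl
    exact hfix y hx hy
  obtain ⟨w, hw0, hwn, hadj, hne⟩ := hT.connected.exists_geodesic y x
  generalize T.dist y x = n at *
  have hb1 : b (w 1) ≠ w 1 := fun h ↦ by
    have h1 := hT.connected.dist_le_of_adj hadj (i := 1) hn le_rfl
    have h2 := hmin _ _ h hx
    rw [hwn] at h1
    omega
  have ha1 : a (w (n - 1)) ≠ w (n - 1) := fun h ↦ by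
    have h1 := hT.connected.dist_le_of_adj hadj (Nat.zero_le (n - 1)) (by omega)
    have h2 := hmin _ _ hy h
    rw [hw0] at h1
    omega
  let p : ℕ → V := fun i ↦ if i ≤ n then w i else a (w (2 * n - i))
  have hp_le {i : ℕ} (hi : i ≤ n) : p i = w i := if_pos hi
  have hp_ge {i : ℕ} (hi : n ≤ i) : p i = a (w (2 * n - i)) := by
    rcases hi.eq_or_lt with rfl | hi
    · rw [hp_le le_rfl, show 2 * n - n = n by omega, hwn, hx]
    · exact if_neg (by omega)
  refine hT.pow_apply_ne_of_axis (g := a * b) (p := p) (m := 2 * n)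
    (fun u v h ↦ ha _ _ (hb _ _ h)) (by omega) ?_ (fun i hi ↦ ?_) (fun i hi ↦ ?_) ?_ hk
    (by rw [hab, Equiv.Perm.one_apply])
  · rw [hp_ge (by omega), hp_le (Nat.zero_le n), Nat.sub_self, Equiv.Perm.mul_apply, hw0, hy]
  · by_cases hin : i < n
    · rw [hp_le hin.le, hp_le hin]
      exact hadj i hin
    · rw [hp_ge (by omega), hp_ge (by omega), show 2 * n - i = 2 * n - (i + 1) + 1 by omega]
      exact ha _ _ (hadj _ (by omega)).symm
  · rcases lt_trichotomy (i + 1) n with hin | hin | hin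
    · rw [hp_le (by omega), hp_le (by omega)]
      exact hne i hin
    · rw [hp_ge (by omega), hp_le (by omega), show 2 * n - (i + 2) = n - 1 by omega,
        show i = n - 1 by omega]
      exact ha1
    · rw [hp_ge (by omega), hp_ge (by omega), show 2 * n - i = 2 * n - (i + 2) + 2 by omega]
      exact a.injective.ne (hne _ (by omega)).symm
  · rw [hp_le hn, hp_ge (by omega), show 2 * n - (2 * n - 1) = 1 by omega, Equiv.Perm.mul_apply]
    exact a.injective.ne hb1

end SimpleGraph

/-- The (2,3,6) triangle group `Δ(2,3,6) = ⟨a, b : a², b³, (ab)⁶⟩` has Property (FA). -/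
theorem triangle_236_propertyFA : HasPropertyFA (PresentedGroup triangleRels236) := by
  intro V T φ hconn hacyc hadj hinv
  have hT : T.IsTree := ⟨hconn, hacyc⟩
  let a : PresentedGroup triangleRels236 := PresentedGroup.of 0
  let b : PresentedGroup triangleRels236 := PresentedGroup.of 1
  have ha : a ^ 2 = 1 := PresentedGroup.one_of_mem (x := FreeGroup.of 0 ^ 2) (.inl rfl)
  have hb : b ^ 3 = 1 := PresentedGroup.one_of_mem (x := FreeGroup.of 1 ^ 3) (.inr (.inl rfl))
  have hab : (a * b) ^ 6 = 1 :=
    PresentedGroup.one_of_mem (x := (FreeGroup.of 0 * FreeGroup.of 1) ^ 6) (.inr (.inr rfl))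
  obtain ⟨v, hav, hbv⟩ := hT.exists_common_fixed_of_mul_pow_eq_one (hadj a) (hadj b)
    (hT.exists_apply_eq_of_pow_eq_one (hadj a) (hinv a) two_pos (by rw [← map_pow, ha, map_one]))
    (hT.exists_apply_eq_of_pow_eq_one (hadj b) (hinv b) three_pos (by rw [← map_pow, hb, map_one]))
    (k := 6) (by norm_num) (by rw [← map_mul, ← map_pow, hab, map_one])
  refine ⟨v, fun g ↦ ?_⟩
  have hg : g ∈ (MulAction.stabilizer (Equiv.Perm V) v).comap φ := by
    have htop := PresentedGroup.closure_range_of triangleRels236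
    refine (Subgroup.closure_le _).mpr ?_ (htop ▸ Subgroup.mem_top g)
    rintro _ ⟨i, rfl⟩
    fin_cases i
    · exact hav
    · exact hbv
  exact hg
end

section
/- Let α, β ∈ ℂ satisfy α·conj(α) − 2·Im(α)·β·i = 1, and let R be the 2×2 complex matrix with rows (α, β) and (2·Im(α)·i, conj(α)), and S the 2×2 complex matrix with rows (1, −1) and (0, −1). Then det(R) = 1, S² = I, and S·R·S⁻¹ = R⁻¹; consequently there is a group homomorphism from the infinite dihedral group D∞ = ⟨r, s : s² = 1, (sr)² = 1⟩ to GL(2, ℂ) sending r to R and s to S. -/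
open Complex

/-- Elements `a`, `b` of a group with `b² = 1` and `b·a·b⁻¹ = a⁻¹` determine a homomorphism from
the infinite dihedral group sending `r` to `a` and `s` to `b`. -/
def DihedralGroup.liftInfinite {G : Type*} [Group G] (a b : G) (hb : b * b = 1)
    (hab : b * a * b⁻¹ = a⁻¹) : DihedralGroup 0 →* G :=
  have zpow_mul_comm (i : ℤ) : a ^ i * b = b * a ^ (-i) := by
    have hconj : b * a ^ (-i) * b⁻¹ = a ^ i := by
      rw [← conj_zpow, hab, inv_zpow', neg_neg]
    rw [← hconj, inv_mul_cancel_right]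
  have zpow_mul_reflection (i j : ℤ) : b * a ^ (j - i) = a ^ i * (b * a ^ j) := by
    rw [← mul_assoc, zpow_mul_comm, mul_assoc, ← zpow_add, neg_add_eq_sub]
  have reflection_mul_zpow (i j : ℤ) : b * a ^ (i + j) = b * a ^ i * a ^ j := by
    rw [zpow_add, mul_assoc]
  have reflection_mul_reflection (i j : ℤ) : a ^ (j - i) = b * a ^ i * (b * a ^ j) := by
    rw [mul_assoc, ← zpow_mul_reflection, ← mul_assoc, hb, one_mul]
  MonoidHom.mk'
    (fun
      | .r i => a ^ (show ℤ from i)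
      | .sr i => b * a ^ (show ℤ from i))
    (by
      rintro (i | i) (j | j)
      · exact zpow_add a _ _
      · exact zpow_mul_reflection i j
      · exact reflection_mul_zpow i j
      · exact reflection_mul_reflection i j)

theorem DihedralGroup.liftInfinite_r_one {G : Type*} [Group G] (a b : G) (hb : b * b = 1)
    (hab : b * a * b⁻¹ = a⁻¹) :
    DihedralGroup.liftInfinite a b hb hab (.r (1 : ZMod 0)) = a :=
  zpow_one a

theorem DihedralGroup.liftInfinite_sr_zero {G : Type*} [Group G] (a b : G) (hb : b * b = 1)
    (hab : b * a * b⁻¹ = a⁻¹) :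
    DihedralGroup.liftInfinite a b hb hab (.sr (0 : ZMod 0)) = b :=
  (congrArg (b * ·) (zpow_zero a)).trans (mul_one b)

/-- Let `α, β ∈ ℂ` with `α·conj(α) − 2·Im(α)·β·i = 1`, and let
`R = !![α, β; 2·Im(α)·i, conj α]`, `S = !![1, -1; 0, -1]`. Then `det R = 1`, `S² = 1`,
`S·R·S⁻¹ = R⁻¹`, and there is a homomorphism `D∞ → GL(2,ℂ)` with `r ↦ R`, `s ↦ S`. -/
theorem dihedral_rep_of_det_one (α β : ℂ)
    (h : α * (starRingEnd ℂ) α - 2 * (α.im : ℂ) * β * Complex.I = 1) :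
    let R : Matrix (Fin 2) (Fin 2) ℂ :=
      !![α, β; 2 * (α.im : ℂ) * Complex.I, (starRingEnd ℂ) α]
    let S : Matrix (Fin 2) (Fin 2) ℂ := !![1, -1; 0, -1]
    R.det = 1 ∧ S * S = 1 ∧ S * R * S⁻¹ = R⁻¹ ∧
      ∃ ρ : DihedralGroup 0 →* Matrix.GeneralLinearGroup (Fin 2) ℂ,
        (ρ (DihedralGroup.r (1 : ZMod 0)) : Matrix (Fin 2) (Fin 2) ℂ) = R ∧
        (ρ (DihedralGroup.sr (0 : ZMod 0)) : Matrix (Fin 2) (Fin 2) ℂ) = S := by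
  intro R S
  have hdet : R.det = 1 := by
    rw [Matrix.det_fin_two_of]
    linear_combination h
  have hS : S * S = 1 := by
    simp [S, Matrix.one_fin_two]
  have hSinv : S⁻¹ = S := Matrix.inv_eq_right_inv hS
  have hRS : S * R * S⁻¹ = R⁻¹ := by
    have him : (starRingEnd ℂ) α = α - 2 * (α.im : ℂ) * I := by
      have hsub := Complex.sub_conj α
      push_cast at hsub
      linear_combination -hsub
    rw [hSinv, Matrix.inv_def, hdet, Ring.inverse_one, one_smul, Matrix.adjugate_fin_two_of]
    simp only [R, S, Matrix.mul_fin_two, him]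
    ext i j
    fin_cases i <;> fin_cases j <;> simp <;> ring
  refine ⟨hdet, hS, hRS, ?_⟩
  let a : GL (Fin 2) ℂ := Matrix.GeneralLinearGroup.mk'' R (by simp [hdet])
  let b : GL (Fin 2) ℂ := ⟨S, S, hS, hS⟩
  have hb : b * b = 1 := Units.ext hS
  have hab : b * a * b⁻¹ = a⁻¹ := by
    ext1
    rw [Matrix.coe_units_inv]
    exact (congrArg (S * R * ·) hSinv.symm).trans hRS
  exact ⟨DihedralGroup.liftInfinite a b hb hab,
    congrArg Units.val (DihedralGroup.liftInfinite_r_one a b hb hab),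
    congrArg Units.val (DihedralGroup.liftInfinite_sr_zero a b hb hab)⟩
end
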